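/- Let w be the Fermat polynomial of degree d with weights c_1,…,c_N, let n ≥ 1, and let g_1,…,g_n ∈ G_max(w). Assume that at least n−1 of the elements g_1,…,g_n are narrow. Then for every j = 1,…,N one has (c_j/d)·(n−2) − Σ_{i=1}^n m_j(g_i) < 0. -/

import Mathlib

open MvPolynomial

/-- A diagonal symmetry of a Fermat polynomial `∑ j, X j ^ e j` with positive exponents has `j`-th
coordinate an `e j`-th root of unity. -/
lemma pow_eq_one_of_bind₁_fermat_eq {ι R : Type*} [Fintype ι] [CommRing R]
    (e : ι → ℕ) (he : ∀ j, e j ≠ 0) (a : ι → R)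
    (h : bind₁ (fun j => C (a j) * X j) (∑ j, X j ^ e j : MvPolynomial ι R) = ∑ j, X j ^ e j)
    (j : ι) : a j ^ e j = 1 := by
  classical
  have key := congrArg (eval (Pi.single j (1 : R))) h
  simp only [map_sum, map_pow, bind₁_X_right, map_mul, eval_C, eval_X] at key
  rw [Finset.sum_eq_single j, Finset.sum_eq_single j] at key
  · simpa using key
  · intro b _ hb
    simp [hb, he b]
  · simp
  · intro b _ hb
    simp [hb, he b]
  · simp

/-- A nontrivial `e`-th root of unity `exp (2πi t)` with `t ≥ 0` has `t ≥ 1 / e`. -/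
lemma one_le_mul_of_exp_pow_eq_one {t : ℝ} (ht : 0 ≤ t) {e : ℕ} (he : 0 < e)
    (h1 : Complex.exp (2 * (Real.pi : ℂ) * Complex.I * (t : ℂ)) ≠ 1)
    (hpow : Complex.exp (2 * (Real.pi : ℂ) * Complex.I * (t : ℂ)) ^ e = 1) :
    1 ≤ (e : ℝ) * t := by
  have ht0 : t ≠ 0 := by
    rintro rfl
    simp at h1
  rw [← Complex.exp_nat_mul, Complex.exp_eq_one_iff] at hpow
  obtain ⟨k, hk⟩ := hpow
  have hC : ((e : ℂ) * t) = k := by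
    apply mul_right_cancel₀ Complex.two_pi_I_ne_zero
    rw [← hk]
    ring
  have hR : (e : ℝ) * t = k := by exact_mod_cast hC
  have hpos : (0 : ℝ) < k := by
    rw [← hR]
    have : 0 < t := lt_of_le_of_ne ht ht0.symm
    positivity
  rw [hR]
  have : 0 < k := by exact_mod_cast hpos
  exact_mod_cast this

/-- Degree negativity for genus-zero W-structures: if `g_1, …, g_n ∈ G_max(w)`
with at least `n - 1` of them narrow, then for every `j`,
`(c_j/d)(n-2) - ∑_i m_j(g_i) < 0`. -/
theorem genus_zero_degree_negative (N d : ℕ) (c : Fin N → ℕ)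
    (hd : 0 < d) (hc : ∀ j, 0 < c j) (hcd : ∀ j, c j ∣ d)
    (w : MvPolynomial (Fin N) ℂ) (hw : w = ∑ j, X j ^ (d / c j))
    (n : ℕ) (hn : 1 ≤ n)
    (g : Fin n → Fin N → ℂˣ)
    (hg : ∀ i, bind₁ (fun j => C ((g i j : ℂ)) * X j) w = w)
    (m : Fin n → Fin N → ℝ)
    (hm : ∀ i j, m i j ∈ Set.Ico (0 : ℝ) 1)
    (hgm : ∀ i j, (g i j : ℂ) = Complex.exp (2 * (Real.pi : ℂ) * Complex.I * (m i j : ℂ)))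
    (hnar : ∀ i i' : Fin n, ¬(∀ j, g i j ≠ 1) → ¬(∀ j, g i' j ≠ 1) → i = i') :
    ∀ j, (c j : ℝ) / d * ((n : ℝ) - 2) - ∑ i, m i j < 0 := by
  intro j
  subst hw
  have he : ∀ j, 0 < d / c j := fun j => Nat.div_pos (Nat.le_of_dvd hd (hcd j)) (hc j)
  have hcj : (0 : ℝ) < c j := by exact_mod_cast hc j
  have hdR : (0 : ℝ) < d := by exact_mod_cast hd
  have hq : (0 : ℝ) < c j / d := by positivity
  have hlow : ∀ i, g i j ≠ 1 → (c j : ℝ) / d ≤ m i j := by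
    intro i hi
    have hpow := pow_eq_one_of_bind₁_fermat_eq _ (fun j => (he j).ne') _ (hg i) j
    have hne : (g i j : ℂ) ≠ 1 := by simpa using hi
    rw [hgm] at hpow hne
    have h := one_le_mul_of_exp_pow_eq_one (hm i j).1 (he j) hne hpow
    rw [Nat.cast_div (hcd j) hcj.ne', div_mul_eq_mul_div, le_div_iff₀ hcj] at h
    rw [div_le_iff₀ hdR]
    linarith
  obtain ⟨i₀, hi₀⟩ : ∃ i₀, ∀ i ≠ i₀, g i j ≠ 1 := by
    by_cases h : ∃ i, ¬ ∀ j, g i j ≠ 1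
    · obtain ⟨i₀, h₀⟩ := h
      refine ⟨i₀, fun i hi => ?_⟩
      by_contra hcon
      exact hi (hnar i i₀ (fun hall => hall j hcon) h₀)
    · push Not at h
      exact ⟨⟨0, hn⟩, fun i _ => h i j⟩
  have hsum : ((n : ℝ) - 1) * (c j / d) ≤ ∑ i, m i j := by
    calc ((n : ℝ) - 1) * (c j / d)
        = ∑ _i ∈ Finset.univ.erase i₀, (c j : ℝ) / d := by
          simp [Finset.card_erase_of_mem, Nat.cast_sub hn]
      _ ≤ ∑ i ∈ Finset.univ.erase i₀, m i j :=
          Finset.sum_le_sum fun i hi => hlow i (hi₀ i (Finset.ne_of_mem_erase hi))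
      _ ≤ ∑ i, m i j :=
          Finset.sum_le_sum_of_subset_of_nonneg (Finset.erase_subset _ _)
            fun i _ _ => (hm i j).1
  linarith
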